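/- arXiv:2204.07039 — 3 statements merged into one kernel-verified Lean document; each statement's English description precedes it below -/
import Mathlib

section
/- Let N=(P,T,ℂ,𝔹,C,G,W,W_I,M₀) be a CPN, δ a stable partition of N, and N^δ the quotiented CPN. Then the initial marking M₀ of N and the initial marking M₀^δ of N^δ are bisimilar (with both LTSs labeled by the common transition names: ℓ(t)=t in both nets). -/
/- Formalization of colored Petri nets (CPN) following the paper's definitions. -/

noncomputable section
attribute [local instance] Classical.propDecidable
attribute [local instance] Classical.decEq

/-- A colored Petri net `N = (P,T,ℂ,𝔹,C,G,W,W_I,M₀)`: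
`dom` is the place color type function `C`, `guard` the guard evaluation `G`,
`pre`/`post` the arc evaluation `W` for place-to-transition and transition-to-place arcs,
`inhib` the inhibitor arc weight `W_I` (with `⊤` meaning no inhibitor arc),
and `M0` the initial marking. -/
structure CPN (P T C B : Type) where
  dom : P → Set C
  guard : T → B → Prop
  pre : P → T → B → Multiset C
  post : T → P → B → Multiset C
  inhib : P → T → ℕ∞
  M0 : P → Multiset C

variable {P T C B : Type}

/-- Well-formedness conditions from the definition of a CPN: color domains are nonempty,
arc expressions only use colors from the color domain of the connected place, inhibitor
weights are positive, and the initial marking is a marking. -/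
def CPN.WF (N : CPN P T C B) : Prop :=
  (∀ p, (N.dom p).Nonempty) ∧
  (∀ p t b, ∀ c ∈ N.pre p t b, c ∈ N.dom p) ∧
  (∀ p t b, ∀ c ∈ N.post t p b, c ∈ N.dom p) ∧
  (∀ p t, 0 < N.inhib p t) ∧
  (∀ p, ∀ c ∈ N.M0 p, c ∈ N.dom p)

/-- `M` is a marking of `N`: `set(M(p)) ⊆ C(p)` for all places `p`. -/
def CPN.IsMk (N : CPN P T C B) (M : P → Multiset C) : Prop :=
  ∀ p, ∀ c ∈ M p, c ∈ N.dom p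

/-- Transition firing `M →t M'`: there is a binding `b` satisfying the guard such that
`W((p,t),b) ⊆ M(p)` and `W_I(p,t) > |M(p)|` for all `p`, and
`M'(p) = (M(p) ∖ W((p,t),b)) ⊎ W((t,p),b)` for all `p`. -/
def CPN.Fires (N : CPN P T C B) (M : P → Multiset C) (t : T) (M' : P → Multiset C) : Prop :=
  ∃ b, N.guard t b ∧
    (∀ p, N.pre p t b ≤ M p) ∧
    (∀ p, ((M p).card : ℕ∞) < N.inhib p t) ∧
    (∀ p, M' p = M p - N.pre p t b + N.post t p b)

/-- `Σ_{c∈θ} S(c)`: the number of elements of the multiset `S` whose color lies in `θ`. -/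
def countIn (S : Multiset C) (θ : Set C) : ℕ := (S.filter (· ∈ θ)).card

/-- `M ≡δ M'` iff for all `p ∈ P` and all `θ ∈ δ(p)`, `Σ_{c∈θ}M(p)(c) = Σ_{c∈θ}M'(p)(c)`. -/
def MarkEquiv (δ : P → Set (Set C)) (M M' : P → Multiset C) : Prop :=
  ∀ p, ∀ θ ∈ δ p, countIn (M p) θ = countIn (M' p) θ

/-- `δ` is a partition of `N`: for each place `p`, the equivalence classes in `δ(p)` are
nonempty, pairwise disjoint, and their union is `C(p)`. -/
def CPN.IsPartition (N : CPN P T C B) (δ : P → Set (Set C)) : Prop :=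
  ∀ p, ∅ ∉ δ p ∧ ⋃₀ δ p = N.dom p ∧
    ∀ θ₁ ∈ δ p, ∀ θ₂ ∈ δ p, θ₁ ≠ θ₂ → θ₁ ∩ θ₂ = ∅

/-- `δ` is stable: the relation `≡δ` on markings of `N` is a bisimulation on the LTS of `N`
labeled by transition names (stated for one direction; the other follows by symmetry of `≡δ`). -/
def CPN.IsStable (N : CPN P T C B) (δ : P → Set (Set C)) : Prop :=
  ∀ M₁ M₂, N.IsMk M₁ → N.IsMk M₂ → MarkEquiv δ M₁ M₂ →
    ∀ t M₁', N.Fires M₁ t M₁' → ∃ M₂', N.Fires M₂ t M₂' ∧ MarkEquiv δ M₁' M₂'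

/-- The equivalence class of the color `c` in the set of classes `D` (the unique `θ ∈ D`
containing `c`, when `D` is a partition and `c` is covered by `D`). -/
def classOf (D : Set (Set C)) (c : C) : Set C := ⋃₀ {θ ∈ D | c ∈ θ}

/-- The quotiented marking: `M^δ(p)(θ) = Σ_{c∈θ} M(p)(c)` for `θ ∈ δ(p)`. -/
def qMark (δ : P → Set (Set C)) (M : P → Multiset C) : P → Multiset (Set C) :=
  fun p => (M p).map (classOf (δ p))

/-- The firing relation of the quotiented CPN `N^δ`, labeled by transition names: `t` fires
under the binding class `[b]_t` of some `b ∈ B(t)`, with quotiented arc evaluations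
`W^δ((p,t),[b]_t)(θ) = Σ_{c∈θ}W((p,t),b)(c)` (and symmetrically for output arcs),
unchanged inhibitor weights, and the standard firing rule. -/
def CPN.QStep (N : CPN P T C B) (δ : P → Set (Set C))
    (M : P → Multiset (Set C)) (t : T) (M' : P → Multiset (Set C)) : Prop :=
  ∃ b, N.guard t b ∧
    (∀ p, (N.pre p t b).map (classOf (δ p)) ≤ M p) ∧
    (∀ p, ((M p).card : ℕ∞) < N.inhib p t) ∧
    (∀ p, M' p = M p - (N.pre p t b).map (classOf (δ p)) + (N.post t p b).map (classOf (δ p)))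

/-- A bisimulation between two labeled transition systems (with a common label type `L`). -/
def IsBisim {S₁ S₂ L : Type} (st₁ : S₁ → L → S₁ → Prop) (st₂ : S₂ → L → S₂ → Prop)
    (R : S₁ → S₂ → Prop) : Prop :=
  (∀ s₁ s₂ a s₁', R s₁ s₂ → st₁ s₁ a s₁' → ∃ s₂', st₂ s₂ a s₂' ∧ R s₁' s₂') ∧
  (∀ s₁ s₂ a s₂', R s₁ s₂ → st₂ s₂ a s₂' → ∃ s₁', st₁ s₁ a s₁' ∧ R s₁' s₂')

/-- Two states are bisimilar iff some bisimulation relates them. -/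
def Bisimilar {S₁ S₂ L : Type} (st₁ : S₁ → L → S₁ → Prop) (st₂ : S₂ → L → S₂ → Prop)
    (s₁ : S₁) (s₂ : S₂) : Prop :=
  ∃ R, IsBisim st₁ st₂ R ∧ R s₁ s₂

theorem CPN.IsPartition.classOf_eq {N : CPN P T C B} {δ : P → Set (Set C)}
    (hpart : N.IsPartition δ) {p : P} {θ : Set C} (hθ : θ ∈ δ p) {c : C} (hc : c ∈ θ) :
    classOf (δ p) c = θ := by
  have h : {θ' ∈ δ p | c ∈ θ'} = {θ} := by
    ext θ'
    constructor
    · rintro ⟨hθ', hc'⟩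
      by_contra hne
      exact Set.notMem_empty c ((hpart p).2.2 θ' hθ' θ hθ hne ▸ ⟨hc', hc⟩)
    · rintro rfl
      exact ⟨hθ, hc⟩
  rw [classOf, h, Set.sUnion_singleton]

theorem CPN.IsPartition.exists_mem {N : CPN P T C B} {δ : P → Set (Set C)}
    (hpart : N.IsPartition δ) {p : P} {c : C} (hc : c ∈ N.dom p) : ∃ θ ∈ δ p, c ∈ θ := by
  rwa [← (hpart p).2.1] at hc

theorem CPN.IsPartition.classOf_mem {N : CPN P T C B} {δ : P → Set (Set C)}
    (hpart : N.IsPartition δ) {p : P} {c : C} (hc : c ∈ N.dom p) : classOf (δ p) c ∈ δ p := by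
  obtain ⟨θ, hθ, hcθ⟩ := hpart.exists_mem hc
  rwa [hpart.classOf_eq hθ hcθ]

theorem CPN.IsPartition.mem_iff_eq_classOf {N : CPN P T C B} {δ : P → Set (Set C)}
    (hpart : N.IsPartition δ) {p : P} {θ : Set C} (hθ : θ ∈ δ p) {c : C} (hc : c ∈ N.dom p) :
    c ∈ θ ↔ θ = classOf (δ p) c := by
  refine ⟨fun h => (hpart.classOf_eq hθ h).symm, ?_⟩
  rintro rfl
  obtain ⟨θ, hθ, hcθ⟩ := hpart.exists_mem hc
  rwa [hpart.classOf_eq hθ hcθ]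

/-- On markings, the count in a class of the partition is a multiplicity in the quotiented
marking. -/
theorem CPN.IsPartition.count_qMark {N : CPN P T C B} {δ : P → Set (Set C)}
    (hpart : N.IsPartition δ) {M : P → Multiset C} (hM : N.IsMk M) {p : P} {θ : Set C}
    (hθ : θ ∈ δ p) : (qMark δ M p).count θ = countIn (M p) θ := by
  rw [qMark, Multiset.count_map, countIn]
  exact congrArg _ (Multiset.filter_congr fun c hc =>
    (hpart.mem_iff_eq_classOf hθ (hM p c hc)).symm)

theorem CPN.IsPartition.markEquiv_iff {N : CPN P T C B} {δ : P → Set (Set C)}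
    (hpart : N.IsPartition δ) {M M' : P → Multiset C} (hM : N.IsMk M) (hM' : N.IsMk M') :
    MarkEquiv δ M M' ↔ qMark δ M = qMark δ M' := by
  constructor
  · intro h
    funext p
    ext θ
    by_cases hθ : θ ∈ δ p
    · rw [hpart.count_qMark hM hθ, hpart.count_qMark hM' hθ, h p θ hθ]
    · have hzero : ∀ {L : P → Multiset C}, N.IsMk L → (qMark δ L p).count θ = 0 := by
        intro L hL
        refine Multiset.count_eq_zero_of_notMem fun hmem => hθ ?_
        obtain ⟨c, hc, rfl⟩ := Multiset.mem_map.1 hmem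
        exact hpart.classOf_mem (hL p c hc)
      rw [hzero hM, hzero hM']
  · intro h p θ hθ
    rw [← hpart.count_qMark hM hθ, ← hpart.count_qMark hM' hθ, h]

theorem CPN.IsMk.of_fires {N : CPN P T C B} (hWF : N.WF) {M M' : P → Multiset C} {t : T}
    (hM : N.IsMk M) (h : N.Fires M t M') : N.IsMk M' := by
  obtain ⟨b, -, -, -, hM'⟩ := h
  intro p c hc
  rw [hM' p, Multiset.mem_add] at hc
  exact hc.elim (fun hc => hM p c (Multiset.mem_of_le (Multiset.sub_le_self _ _) hc))
    (hWF.2.2.1 p t b c)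

theorem Multiset.map_sub_of_le {α β : Type*} [DecidableEq α] [DecidableEq β] (f : α → β)
    {s t : Multiset α} (h : s ≤ t) :
    (t - s).map f = t.map f - s.map f := by
  obtain ⟨u, rfl⟩ := Multiset.le_iff_exists_add.1 h
  rw [Multiset.map_add, add_tsub_cancel_left, add_tsub_cancel_left]

theorem Multiset.exists_le_map_eq {α β : Type*} (f : α → β) {s : Multiset β} {t : Multiset α}
    (h : s ≤ t.map f) : ∃ r ≤ t, r.map f = s := by
  induction s using Multiset.induction_on generalizing t with
  | empty => exact ⟨0, Multiset.zero_le _, rfl⟩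
  | cons b s ih =>
    obtain ⟨a, ha, rfl⟩ := Multiset.mem_map.1 (Multiset.mem_of_le h (Multiset.mem_cons_self b s))
    obtain ⟨t, rfl⟩ := Multiset.exists_cons_of_mem ha
    rw [Multiset.map_cons, Multiset.cons_le_cons_iff] at h
    obtain ⟨r, hr, rfl⟩ := ih h
    exact ⟨a ::ₘ r, Multiset.cons_le_cons a hr, Multiset.map_cons f a r⟩

theorem CPN.Fires.qStep {N : CPN P T C B} (δ : P → Set (Set C)) {M M' : P → Multiset C} {t : T}
    (h : N.Fires M t M') : N.QStep δ (qMark δ M) t (qMark δ M') := by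
  obtain ⟨b, hg, hpre, hinh, hM'⟩ := h
  refine ⟨b, hg, fun p => Multiset.map_le_map (hpre p), fun p => ?_, fun p => ?_⟩
  · rw [qMark, Multiset.card_map]
    exact hinh p
  · rw [qMark, hM' p, Multiset.map_add, Multiset.map_sub_of_le _ (hpre p), qMark]

/-- A step of the quotiented net from `M^δ` is realized in the net itself by a marking with the
same quotient as `M`. -/
theorem CPN.QStep.exists_fires {N : CPN P T C B} (hWF : N.WF) {δ : P → Set (Set C)}
    {M : P → Multiset C} (hM : N.IsMk M) {t : T} {Q : P → Multiset (Set C)}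
    (h : N.QStep δ (qMark δ M) t Q) :
    ∃ L L', N.IsMk L ∧ qMark δ L = qMark δ M ∧ N.Fires L t L' ∧ qMark δ L' = Q := by
  obtain ⟨b, hg, hpre, hinh, hQ⟩ := h
  choose r hr hmap using fun p => Multiset.exists_le_map_eq (classOf (δ p)) (hpre p)
  have hq : qMark δ (fun p => M p - r p + N.pre p t b) = qMark δ M := by
    funext p
    change (M p - r p + N.pre p t b).map _ = (M p).map _
    rw [Multiset.map_add, ← hmap p, ← Multiset.map_add, tsub_add_cancel_of_le (hr p)]
  refine ⟨fun p => M p - r p + N.pre p t b, fun p => M p - r p + N.post t p b, ?_, hq,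
    ⟨b, hg, fun p => Multiset.le_add_left _ _, fun p => ?_, fun p => ?_⟩, ?_⟩
  · intro p c hc
    exact (Multiset.mem_add.1 hc).elim
      (fun hc => hM p c (Multiset.mem_of_le (Multiset.sub_le_self _ _) hc)) (hWF.2.1 p t b c)
  · have hcard := congrArg Multiset.card (congrFun hq p)
    simp only [qMark, Multiset.card_map] at hcard
    rw [hcard]
    simpa only [qMark, Multiset.card_map] using hinh p
  · rw [add_tsub_cancel_right]
  · funext p
    rw [hQ p, qMark, Multiset.map_add, Multiset.map_sub_of_le _ (hr p), hmap p, qMark]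

/-- If `δ` is a stable partition of the CPN `N`, then the initial marking `M₀`
of `N` and the initial marking `M₀^δ` of the quotiented CPN `N^δ` are bisimilar (both LTSs
labeled by the common transition names). -/
theorem quotiented_net_bisimilar [Fintype P] [Fintype T] (N : CPN P T C B) (hWF : N.WF)
    (δ : P → Set (Set C)) (hpart : N.IsPartition δ) (hstable : N.IsStable δ) :
    Bisimilar N.Fires (N.QStep δ) N.M0 (qMark δ N.M0) := by
  refine ⟨fun M Q => N.IsMk M ∧ Q = qMark δ M, ⟨?_, ?_⟩, hWF.2.2.2.2, rfl⟩
  · rintro M _ t M' ⟨hM, rfl⟩ hf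
    exact ⟨qMark δ M', hf.qStep δ, hM.of_fires hWF hf, rfl⟩
  · rintro M _ t Q ⟨hM, rfl⟩ hs
    obtain ⟨L, L', hL, hLM, hf, rfl⟩ := hs.exists_fires hWF hM
    obtain ⟨M', hf', he⟩ :=
      hstable L M hL hM ((hpart.markEquiv_iff hL hM).2 hLM) t L' hf
    have hM' := hM.of_fires hWF hf'
    exact ⟨M', hf', hM', (hpart.markEquiv_iff (hL.of_fires hWF hf) hM').1 he⟩

end
end

section
/- Every CPN N (with finite color domains C(p) for all places p, so that the refinement order on partitions is well-founded) has a unique maximum stable partition: there exists a stable partition δ such that δ ≥ δ' for every stable partition δ' of N, and such δ is unique. -/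
/- Formalization of colored Petri nets (CPN) following the paper's definitions. -/

noncomputable section
attribute [local instance] Classical.propDecidable
attribute [local instance] Classical.decEq

variable {P T C B : Type}

/-- The relation `↔` on classes of `D`: `θ ↔ θ'` iff `θ,θ' ∈ D` and `θ ∩ θ' ≠ ∅`. -/
def linked (D : Set (Set C)) (θ θ' : Set C) : Prop :=
  θ ∈ D ∧ θ' ∈ D ∧ (θ ∩ θ').Nonempty

/-- `[θ] = ⋃ {θ' ∈ D : θ ↔* θ'}` where `↔*` is the reflexive-transitive closure of `↔`. -/
def classUnion (D : Set (Set C)) (θ : Set C) : Set C :=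
  ⋃₀ {θ' ∈ D | Relation.ReflTransGen (linked D) θ θ'}

/-- The partition union `δ₁ ⊔ δ₂`: `(δ₁ ⊔ δ₂)(p) = {[θ] : θ ∈ δ₁(p) ∪ δ₂(p)}`. -/
def partUnion (δ₁ δ₂ : P → Set (Set C)) : P → Set (Set C) :=
  fun p => classUnion (δ₁ p ∪ δ₂ p) '' (δ₁ p ∪ δ₂ p)

/-- Refinement order on partitions: `δ ≥ δ'` iff every class of `δ'(p)` is contained in some
class of `δ(p)`, for every place `p`. -/
def PartGE (δ δ' : P → Set (Set C)) : Prop :=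
  ∀ p, ∀ θ' ∈ δ' p, ∃ θ ∈ δ p, θ' ⊆ θ

/-- Strict refinement: `δ > δ'` iff `δ ≥ δ'` and `δ ≠ δ'`. -/
def PartGT (δ δ' : P → Set (Set C)) : Prop := PartGE δ δ' ∧ δ ≠ δ'

/-- Two colors lie in a common class of `D`. -/
def SameClass (D : Set (Set C)) (c c' : C) : Prop :=
  ∃ θ ∈ D, c ∈ θ ∧ c' ∈ θ

theorem SameClass.symm {D : Set (Set C)} {c c' : C} (h : SameClass D c c') :
    SameClass D c' c :=
  let ⟨θ, hθ, hc, hc'⟩ := h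
  ⟨θ, hθ, hc', hc⟩

theorem setOf_sameClass_eq {D : Set (Set C)}
    (hD : ∀ θ₁ ∈ D, ∀ θ₂ ∈ D, θ₁ ≠ θ₂ → θ₁ ∩ θ₂ = ∅) {θ : Set C} (hθ : θ ∈ D) {c : C}
    (hc : c ∈ θ) : {c' | SameClass D c c'} = θ := by
  ext c'
  refine ⟨fun ⟨η, hη, hcη, hc'⟩ => ?_, fun hc' => ⟨θ, hθ, hc, hc'⟩⟩
  by_cases h : η = θ
  · exact h ▸ hc'
  · exact absurd (hD η hη θ hθ h) (Set.Nonempty.ne_empty ⟨c, hcη, hc⟩)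

theorem countIn_eq_of_rel {ρ : C → C → Prop} {s s' : Multiset C} {θ : Set C}
    (h : Multiset.Rel ρ s s') (hρ : ∀ a b, ρ a b → (a ∈ θ ↔ b ∈ θ)) :
    countIn s θ = countIn s' θ := by
  unfold countIn
  induction h with
  | zero => rfl
  | @cons a b as bs hab _ ih =>
    by_cases ha : a ∈ θ
    · have hb := (hρ a b hab).1 ha
      simp [ha, hb, ih]
    · have hb : b ∉ θ := fun hb => ha ((hρ a b hab).2 hb)
      simp [ha, hb, ih]

theorem rel_sameClass_of_countIn_eq {D : Set (Set C)}
    (hD : ∀ θ₁ ∈ D, ∀ θ₂ ∈ D, θ₁ ≠ θ₂ → θ₁ ∩ θ₂ = ∅) {s s' : Multiset C}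
    (hs : ∀ c ∈ s, c ∈ ⋃₀ D) (hs' : ∀ c ∈ s', c ∈ ⋃₀ D)
    (h : ∀ θ ∈ D, countIn s θ = countIn s' θ) : Multiset.Rel (SameClass D) s s' := by
  have hcount : ∀ t : Multiset C, (∀ c ∈ t, c ∈ ⋃₀ D) → ∀ θ,
      (t.map fun c => {c' | SameClass D c c'}).count θ = if θ ∈ D then countIn t θ else 0 := by
    intro t ht θ
    rw [Multiset.count_map]
    split_ifs with hθ
    · refine congrArg Multiset.card (Multiset.filter_congr fun a ha => ?_)
      obtain ⟨η, hη, haη⟩ := ht a ha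
      rw [setOf_sameClass_eq hD hη haη]
      refine ⟨fun e => e ▸ haη, fun haθ => ?_⟩
      rw [← setOf_sameClass_eq hD hη haη, setOf_sameClass_eq hD hθ haθ]
    · rw [Multiset.card_eq_zero, Multiset.filter_eq_nil]
      intro a ha e
      obtain ⟨η, hη, haη⟩ := ht a ha
      rw [setOf_sameClass_eq hD hη haη] at e
      exact hθ (e ▸ hη)
  have hmap : (s.map fun c => {c' | SameClass D c c'}) =
      s'.map fun c => {c' | SameClass D c c'} := by
    ext θ
    rw [hcount s hs, hcount s' hs']
    split_ifs with hθ
    · exact h θ hθ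
    · rfl
  refine (Multiset.rel_map.1 (Multiset.rel_eq.2 hmap)).mono fun a _ b hb hab => ?_
  obtain ⟨η, hη, hbη⟩ := hs' b hb
  have hbb : b ∈ {c' | SameClass D b c'} := ⟨η, hη, hbη, hbη⟩
  rw [← hab] at hbb
  exact hbb

theorem CPN.Fires.isMk {N : CPN P T C B} (hWF : N.WF) {M M' : P → Multiset C} {t : T}
    (h : N.Fires M t M') (hM : N.IsMk M) : N.IsMk M' := by
  obtain ⟨b, -, -, -, hM'⟩ := h
  intro p c hc
  rw [hM', Multiset.mem_add] at hc
  rcases hc with hc | hc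
  · exact hM p c (Multiset.mem_of_le (Multiset.sub_le_self _ _) hc)
  · exact hWF.2.2.1 p t b c hc

theorem partGE_antisymm {N : CPN P T C B} {δ δ' : P → Set (Set C)} (hδ : N.IsPartition δ)
    (hδ' : N.IsPartition δ') (h : PartGE δ δ') (h' : PartGE δ' δ) : δ = δ' := by
  have key : ∀ {δ δ' : P → Set (Set C)}, N.IsPartition δ → PartGE δ δ' → PartGE δ' δ →
      ∀ p, δ p ⊆ δ' p := by
    intro δ δ' hδ h h' p θ hθ
    obtain ⟨η, hη, hθη⟩ := h' p θ hθ
    obtain ⟨ζ, hζ, hηζ⟩ := h p η hη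
    obtain ⟨c, hc⟩ : θ.Nonempty :=
      Set.nonempty_iff_ne_empty.2 fun e => (hδ p).1 (e ▸ hθ)
    have e : ζ = θ := by
      rw [← setOf_sameClass_eq (hδ p).2.2 hθ hc,
        setOf_sameClass_eq (hδ p).2.2 hζ (hηζ (hθη hc))]
    subst e
    exact hθη.antisymm hηζ ▸ hη
  funext p
  exact (key hδ h h' p).antisymm (key hδ' h' h p)

/-- Two colors of `p` lie in a common class of some stable partition. -/
def CPN.StableLink (N : CPN P T C B) (p : P) (c c' : C) : Prop :=
  ∃ δ, N.IsPartition δ ∧ N.IsStable δ ∧ SameClass (δ p) c c'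

/-- The join of all stable partitions. -/
def CPN.stableJoin (N : CPN P T C B) (p : P) : Set (Set C) :=
  (fun c => {c' | Relation.ReflTransGen (N.StableLink p) c c'}) '' N.dom p

/-- Two markings are equivalent under some stable partition. -/
def CPN.StableStep (N : CPN P T C B) (M M' : P → Multiset C) : Prop :=
  N.IsMk M ∧ N.IsMk M' ∧ ∃ δ, N.IsPartition δ ∧ N.IsStable δ ∧ MarkEquiv δ M M'

theorem CPN.StableLink.symm {N : CPN P T C B} {p : P} {c c' : C} (h : N.StableLink p c c') :
    N.StableLink p c' c :=
  let ⟨δ, hδ, hs, hc⟩ := h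
  ⟨δ, hδ, hs, hc.symm⟩

theorem CPN.StableLink.mem_dom {N : CPN P T C B} {p : P} {c c' : C}
    (h : N.StableLink p c c') : c' ∈ N.dom p := by
  obtain ⟨δ, hδ, -, θ, hθ, -, hc'⟩ := h
  exact (hδ p).2.1 ▸ ⟨θ, hθ, hc'⟩

theorem reflTransGen_stableLink_symm {N : CPN P T C B} {p : P} {c c' : C}
    (h : Relation.ReflTransGen (N.StableLink p) c c') :
    Relation.ReflTransGen (N.StableLink p) c' c :=
  Relation.ReflTransGen.mono (fun _ _ hl => hl.symm) _ _ h.swap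

theorem reflTransGen_stableLink_mem_dom {N : CPN P T C B} {p : P} {c c' : C}
    (h : Relation.ReflTransGen (N.StableLink p) c c') (hc : c ∈ N.dom p) : c' ∈ N.dom p := by
  cases h with
  | refl => exact hc
  | tail _ hl => exact hl.mem_dom

theorem isPartition_stableJoin (N : CPN P T C B) : N.IsPartition N.stableJoin := by
  intro p
  refine ⟨?_, ?_, ?_⟩
  · rintro ⟨c, -, hc⟩
    exact Set.notMem_empty c (hc ▸ Relation.ReflTransGen.refl)
  · ext c
    constructor
    · rintro ⟨_, ⟨a, ha, rfl⟩, hc⟩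
      exact reflTransGen_stableLink_mem_dom hc ha
    · exact fun hc => ⟨_, ⟨c, hc, rfl⟩, Relation.ReflTransGen.refl⟩
  · rintro _ ⟨a, -, rfl⟩ _ ⟨b, -, rfl⟩ hne
    by_contra hi
    obtain ⟨c, hac, hbc⟩ := Set.nonempty_iff_ne_empty.2 hi
    have hab : Relation.ReflTransGen (N.StableLink p) a b :=
      hac.trans (reflTransGen_stableLink_symm hbc)
    refine hne (Set.ext fun x => ⟨fun hx => ?_, fun hx => hab.trans hx⟩)
    exact (reflTransGen_stableLink_symm hab).trans hx

theorem partGE_stableJoin {N : CPN P T C B} {δ : P → Set (Set C)} (hδ : N.IsPartition δ)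
    (hs : N.IsStable δ) : PartGE N.stableJoin δ := by
  intro p θ hθ
  obtain ⟨c, hc⟩ : θ.Nonempty := Set.nonempty_iff_ne_empty.2 fun e => (hδ p).1 (e ▸ hθ)
  exact ⟨_, ⟨c, (hδ p).2.1 ▸ ⟨θ, hθ, hc⟩, rfl⟩,
    fun c' hc' => .single ⟨δ, hδ, hs, θ, hθ, hc, hc'⟩⟩

theorem CPN.StableStep.markEquiv_stableJoin {N : CPN P T C B} {M M' : P → Multiset C}
    (h : N.StableStep M M') : MarkEquiv N.stableJoin M M' := by
  obtain ⟨hM, hM', δ, hδ, hs, hMM'⟩ := h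
  rintro p _ ⟨a, -, rfl⟩
  have hrel : Multiset.Rel (SameClass (δ p)) (M p) (M' p) :=
    rel_sameClass_of_countIn_eq (hδ p).2.2 (fun c hc => (hδ p).2.1 ▸ hM p c hc)
      (fun c hc => (hδ p).2.1 ▸ hM' p c hc) (hMM' p)
  refine countIn_eq_of_rel hrel fun b c hbc => ?_
  have hl : N.StableLink p b c := ⟨δ, hδ, hs, hbc⟩
  exact ⟨fun hb => Relation.ReflTransGen.tail hb hl,
    fun hc => Relation.ReflTransGen.tail hc hl.symm⟩

theorem markEquiv_of_reflTransGen {N : CPN P T C B} {M M' : P → Multiset C}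
    (h : Relation.ReflTransGen N.StableStep M M') : MarkEquiv N.stableJoin M M' := by
  induction h with
  | refl => exact fun _ _ _ => rfl
  | tail _ hl ih => exact fun p θ hθ => (ih p θ hθ).trans (hl.markEquiv_stableJoin p θ hθ)

theorem exists_fires_of_reflTransGen {N : CPN P T C B} (hWF : N.WF)
    {M₁ M₂ M₁' : P → Multiset C} {t : T} (h : Relation.ReflTransGen N.StableStep M₁ M₂)
    (hf : N.Fires M₁ t M₁') :
    ∃ M₂', N.Fires M₂ t M₂' ∧ Relation.ReflTransGen N.StableStep M₁' M₂' := by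
  induction h with
  | refl => exact ⟨M₁', hf, .refl⟩
  | tail _ hl ih =>
    obtain ⟨K, hK, hMK⟩ := ih
    obtain ⟨hA, hA', δ, hδ, hs, he⟩ := hl
    obtain ⟨L, hL, hKL⟩ := hs _ _ hA hA' he t K hK
    exact ⟨L, hL, hMK.tail ⟨hK.isMk hWF hA, hL.isMk hWF hA', δ, hδ, hs, hKL⟩⟩

theorem isMk_update {N : CPN P T C B} {M : P → Multiset C} (hM : N.IsMk M) {p : P}
    {s : Multiset C} (hs : ∀ c ∈ s, c ∈ N.dom p) : N.IsMk (Function.update M p s) := by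
  intro q c hc
  by_cases hq : q = p
  · subst hq
    exact hs c (by simpa using hc)
  · exact hM q c (by simpa [hq] using hc)

theorem stableStep_update_cons {N : CPN P T C B} {M : P → Multiset C} (hM : N.IsMk M) {p : P}
    {s : Multiset C} (hs : ∀ c ∈ s, c ∈ N.dom p) {a b : C} (hab : N.StableLink p a b) :
    N.StableStep (Function.update M p (a ::ₘ s)) (Function.update M p (b ::ₘ s)) := by
  refine ⟨isMk_update hM (Multiset.forall_mem_cons.2 ⟨hab.symm.mem_dom, hs⟩),
    isMk_update hM (Multiset.forall_mem_cons.2 ⟨hab.mem_dom, hs⟩), ?_⟩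
  obtain ⟨δ, hδ, hst, hc⟩ := hab
  refine ⟨δ, hδ, hst, fun q θ hθ => ?_⟩
  by_cases hq : q = p
  · subst hq
    simp only [Function.update_self]
    refine countIn_eq_of_rel (ρ := fun x y => x ∈ θ ↔ y ∈ θ) (.cons ?_ ?_) fun _ _ h => h
    · constructor <;> intro hx
      · exact (setOf_sameClass_eq (hδ q).2.2 hθ hx).subset hc
      · exact (setOf_sameClass_eq (hδ q).2.2 hθ hx).subset hc.symm
    · exact Multiset.rel_refl_of_refl_on fun _ _ => Iff.rfl
  · simp [hq]

theorem reflTransGen_update_cons {N : CPN P T C B} {M : P → Multiset C} (hM : N.IsMk M)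
    {p : P} {s : Multiset C} (hs : ∀ c ∈ s, c ∈ N.dom p) {a b : C}
    (hab : Relation.ReflTransGen (N.StableLink p) a b) :
    Relation.ReflTransGen N.StableStep (Function.update M p (a ::ₘ s))
      (Function.update M p (b ::ₘ s)) :=
  hab.lift (fun c => Function.update M p (c ::ₘ s)) fun _ _ h => stableStep_update_cons hM hs h

theorem reflTransGen_update_of_rel {N : CPN P T C B} {M : P → Multiset C} (hM : N.IsMk M)
    {p : P} {s s' : Multiset C}
    (h : Multiset.Rel (Relation.ReflTransGen (N.StableLink p)) s s') {u : Multiset C}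
    (hs : ∀ c ∈ s, c ∈ N.dom p) (hu : ∀ c ∈ u, c ∈ N.dom p) :
    Relation.ReflTransGen N.StableStep (Function.update M p (s + u))
      (Function.update M p (s' + u)) := by
  induction h generalizing u with
  | zero => exact .refl
  | @cons a b as bs hab _ ih =>
    obtain ⟨ha, has⟩ := Multiset.forall_mem_cons.1 hs
    have h₁ := reflTransGen_update_cons (s := as + u) hM
      (fun c hc => (Multiset.mem_add.1 hc).elim (has c) (hu c)) hab
    have h₂ := ih (u := b ::ₘ u) has
      (Multiset.forall_mem_cons.2 ⟨reflTransGen_stableLink_mem_dom hab ha, hu⟩)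
    rw [Multiset.add_cons, Multiset.add_cons] at h₂
    rw [Multiset.cons_add, Multiset.cons_add]
    exact h₁.trans h₂

theorem rel_of_markEquiv_stableJoin {N : CPN P T C B} {M M' : P → Multiset C} (hM : N.IsMk M)
    (hM' : N.IsMk M') (h : MarkEquiv N.stableJoin M M') (p : P) :
    Multiset.Rel (Relation.ReflTransGen (N.StableLink p)) (M p) (M' p) := by
  have hP := isPartition_stableJoin N p
  refine (rel_sameClass_of_countIn_eq hP.2.2 (fun c hc => hP.2.1 ▸ hM p c hc)
    (fun c hc => hP.2.1 ▸ hM' p c hc) (h p)).mono ?_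
  rintro a - b - ⟨_, ⟨c, -, rfl⟩, ha, hb⟩
  exact (reflTransGen_stableLink_symm ha).trans hb

theorem reflTransGen_of_markEquiv_stableJoin [Fintype P] {N : CPN P T C B}
    {M M' : P → Multiset C} (hM : N.IsMk M) (hM' : N.IsMk M')
    (h : MarkEquiv N.stableJoin M M') : Relation.ReflTransGen N.StableStep M M' := by
  have key : ∀ A : Finset P,
      Relation.ReflTransGen N.StableStep M (fun q => if q ∈ A then M' q else M q) := by
    intro A
    induction A using Finset.induction_on with
    | empty => simpa using Relation.ReflTransGen.refl
    | insert p A hp ih =>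
      refine ih.trans ?_
      have hK : N.IsMk (fun q => if q ∈ A then M' q else M q) := by
        intro q c hc
        dsimp only at hc
        split_ifs at hc
        · exact hM' q c hc
        · exact hM q c hc
      have hstep := reflTransGen_update_of_rel hK (rel_of_markEquiv_stableJoin hM hM' h p)
        (u := 0) (hM p) (by simp)
      rw [add_zero, add_zero] at hstep
      convert hstep using 1
      · funext q
        by_cases hq : q = p
        · subst hq
          simp [hp]
        · simp [hq]
      · funext q
        by_cases hq : q = p
        · subst hq
          simp
        · simp [hq]
  simpa using key Finset.univ

theorem isStable_stableJoin [Fintype P] {N : CPN P T C B} (hWF : N.WF) :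
    N.IsStable N.stableJoin := by
  intro M₁ M₂ hM₁ hM₂ h t M₁' hf
  obtain ⟨M₂', hf', h'⟩ :=
    exists_fires_of_reflTransGen hWF (reflTransGen_of_markEquiv_stableJoin hM₁ hM₂ h) hf
  exact ⟨M₂', hf', markEquiv_of_reflTransGen h'⟩

/-- Every CPN `N` with finite color domains has a unique maximum stable
partition: a stable partition `δ` with `δ ≥ δ'` for every stable partition `δ'`, and such `δ`
is unique. -/
theorem exists_unique_max_stable_partition [Fintype P] [Fintype T] (N : CPN P T C B)
    (hWF : N.WF) (hdom : ∀ p, (N.dom p).Finite) :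
    ∃! δ : P → Set (Set C), (N.IsPartition δ ∧ N.IsStable δ) ∧
      ∀ δ', N.IsPartition δ' → N.IsStable δ' → PartGE δ δ' := by
  have hP := isPartition_stableJoin N
  have hS := isStable_stableJoin hWF
  refine ⟨N.stableJoin, ⟨⟨hP, hS⟩, fun _ hδ hs => partGE_stableJoin hδ hs⟩, ?_⟩
  rintro δ ⟨⟨hδ, hs⟩, hmax⟩
  exact partGE_antisymm hδ hP (hmax _ hP hS) (partGE_stableJoin hδ hs)

end
end

section
/- Let N be a CPN, δ a partition of N, and t∈T a transition. If there exist markings M₁,M₂ of N with M₁ ≡δ M₂ and a marking M₁' with M₁ →t M₁' such that for every marking M₂' with M₂ →t M₂' one has M₁' ≢δ M₂', then there exist markings M₃,M₄ ∈ M^bounded(N) with M₃ ≡δ M₄ and a marking M₃' ∈ M^bounded(N) with M₃ →t M₃' such that for every M₄' ∈ M^bounded(N) with M₄ →t M₄' one has M₃' ≢δ M₄'. -/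
/- Formalization of colored Petri nets (CPN) following the paper's definitions. -/

noncomputable section
attribute [local instance] Classical.propDecidable
attribute [local instance] Classical.decEq

variable {P T C B : Type}

/-- The maximum arc size `max(N) = max_{p,t,b}(|W((p,t),b)|, |W((t,p),b)|)`. -/
def CPN.maxArc (N : CPN P T C B) [Fintype P] [Fintype T] [Fintype B] : ℕ :=
  Finset.univ.sup fun x : P × T × B =>
    max (N.pre x.1 x.2.1 x.2.2).card (N.post x.2.1 x.1 x.2.2).card

/-- `M` is bounded: `|M(p)| ≤ max(N)` for all `p`; together with `IsMk` this says
`M ∈ M^bounded(N)`. -/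
def CPN.Bounded (N : CPN P T C B) [Fintype P] [Fintype T] [Fintype B]
    (M : P → Multiset C) : Prop :=
  ∀ p, (M p).card ≤ N.maxArc

theorem countIn_add (S S' : Multiset C) (θ : Set C) :
    countIn (S + S') θ = countIn S θ + countIn S' θ := by
  simp [countIn]

theorem countIn_cons (a : C) (S : Multiset C) (θ : Set C) :
    countIn (a ::ₘ S) θ = countIn S θ + if a ∈ θ then 1 else 0 := by
  by_cases h : a ∈ θ <;> simp [countIn, h]

theorem countIn_le_of_le {S S' : Multiset C} (h : S ≤ S') (θ : Set C) :
    countIn S θ ≤ countIn S' θ :=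
  Multiset.card_le_card (Multiset.filter_le_filter _ h)

/-- If `S₁` and `S₂` have equally many elements in every class of a disjoint family `D` covering
`S₁`, then every `A ≤ S₁` has a class-wise equinumerous counterpart `A' ≤ S₂`. -/
theorem exists_le_countIn_eq {D : Set (Set C)}
    (hdisj : ∀ θ₁ ∈ D, ∀ θ₂ ∈ D, θ₁ ≠ θ₂ → θ₁ ∩ θ₂ = ∅) {S₁ S₂ : Multiset C}
    (hcover : ∀ c ∈ S₁, c ∈ ⋃₀ D) (heq : ∀ θ ∈ D, countIn S₁ θ = countIn S₂ θ)
    (A : Multiset C) (hA : A ≤ S₁) :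
    ∃ A' ≤ S₂, A'.card = A.card ∧ ∀ θ ∈ D, countIn A θ = countIn A' θ := by
  induction A using Multiset.induction with
  | empty => exact ⟨0, Multiset.zero_le _, rfl, fun _ _ => rfl⟩
  | cons a A ih =>
    obtain ⟨A', hle, hcard, hcount⟩ := ih ((Multiset.le_cons_self A a).trans hA)
    obtain ⟨R, rfl⟩ := Multiset.le_iff_exists_add.mp hle
    obtain ⟨θ, hθ, haθ⟩ := hcover a (Multiset.mem_of_le hA (Multiset.mem_cons_self a A))
    have hpos : 0 < countIn R θ := by
      have hlt := countIn_le_of_le hA θ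
      rw [countIn_cons, if_pos haθ, heq θ hθ, countIn_add, hcount θ hθ] at hlt
      omega
    obtain ⟨c, hc⟩ := Multiset.card_pos_iff_exists_mem.mp hpos
    obtain ⟨hcR, hcθ⟩ := Multiset.mem_filter.mp hc
    have hclass : ∀ x ∈ θ, ∀ θ' ∈ D, x ∈ θ' ↔ θ = θ' := by
      refine fun x hx θ' hθ' => ⟨fun hx' => ?_, fun h => h ▸ hx⟩
      by_contra hne
      exact (hdisj θ hθ θ' hθ' hne).le ⟨hx, hx'⟩
    refine ⟨c ::ₘ A', ?_, by simp [hcard], fun θ' hθ' => ?_⟩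
    · rw [← Multiset.singleton_add, add_comm]
      exact add_le_add_right (Multiset.singleton_le.mpr hcR) A'
    · simp only [countIn_cons, hcount θ' hθ', hclass a haθ θ' hθ', hclass c hcθ θ' hθ']

theorem CPN.card_pre_le_maxArc [Fintype P] [Fintype T] [Fintype B] (N : CPN P T C B)
    (p : P) (t : T) (b : B) : (N.pre p t b).card ≤ N.maxArc :=
  (le_max_left _ _).trans (Finset.le_sup (f := fun x : P × T × B =>
    max (N.pre x.1 x.2.1 x.2.2).card (N.post x.2.1 x.1 x.2.2).card) (Finset.mem_univ (p, t, b)))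

theorem CPN.card_post_le_maxArc [Fintype P] [Fintype T] [Fintype B] (N : CPN P T C B)
    (p : P) (t : T) (b : B) : (N.post t p b).card ≤ N.maxArc :=
  (le_max_right _ _).trans (Finset.le_sup (f := fun x : P × T × B =>
    max (N.pre x.1 x.2.1 x.2.2).card (N.post x.2.1 x.1 x.2.2).card) (Finset.mem_univ (p, t, b)))

/-- Lemma 8(b). If there are markings `M₁ ≡δ M₂` of `N` and `M₁ →t M₁'`
such that every `M₂'` with `M₂ →t M₂'` satisfies `M₁' ≢δ M₂'`, then there are bounded
markings `M₃ ≡δ M₄` in `M^bounded(N)` and a bounded marking `M₃'` with `M₃ →t M₃'` such that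
every `M₄' ∈ M^bounded(N)` with `M₄ →t M₄'` satisfies `M₃' ≢δ M₄'`. -/
theorem bounded_witness_successor [Fintype P] [Fintype T] [Fintype B]
    (N : CPN P T C B) (hWF : N.WF) (δ : P → Set (Set C)) (hpart : N.IsPartition δ) (t : T)
    (M₁ M₂ M₁' : P → Multiset C) (h₁ : N.IsMk M₁) (h₂ : N.IsMk M₂)
    (heq : MarkEquiv δ M₁ M₂) (hstep : N.Fires M₁ t M₁')
    (hall : ∀ M₂', N.Fires M₂ t M₂' → ¬ MarkEquiv δ M₁' M₂') :
    ∃ M₃ M₄ : P → Multiset C, N.IsMk M₃ ∧ N.IsMk M₄ ∧ N.Bounded M₃ ∧ N.Bounded M₄ ∧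
      MarkEquiv δ M₃ M₄ ∧
      ∃ M₃', N.IsMk M₃' ∧ N.Bounded M₃' ∧ N.Fires M₃ t M₃' ∧
        ∀ M₄', N.IsMk M₄' → N.Bounded M₄' → N.Fires M₄ t M₄' →
          ¬ MarkEquiv δ M₃' M₄' := by
  obtain ⟨b, hguard, hpre, hinhib, hsucc⟩ := hstep
  have hcov : ∀ p, ⋃₀ δ p = N.dom p := fun p => (hpart p).2.1
  choose M₄ hM₄le hM₄card hM₄equiv using fun p =>
    exists_le_countIn_eq (hpart p).2.2 (fun c hc => (hcov p).symm ▸ h₁ p c hc) (heq p)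
      (N.pre p t b) (hpre p)
  have hcard : ∀ p, (M₂ p).card ≤ (M₁ p).card := fun p => by
    obtain ⟨A, hA, hAcard, -⟩ := exists_le_countIn_eq (hpart p).2.2
      (fun c hc => (hcov p).symm ▸ h₂ p c hc) (fun θ hθ => (heq p θ hθ).symm) (M₂ p) le_rfl
    exact hAcard ▸ Multiset.card_le_card hA
  refine ⟨fun p => N.pre p t b, M₄, fun p => hWF.2.1 p t b,
    fun p c hc => h₂ p c (Multiset.mem_of_le (hM₄le p) hc),
    fun p => N.card_pre_le_maxArc p t b, fun p => (hM₄card p).trans_le (N.card_pre_le_maxArc p t b),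
    hM₄equiv, fun p => N.post t p b, fun p => hWF.2.2.1 p t b,
    fun p => N.card_post_le_maxArc p t b, ⟨b, hguard, fun p => le_rfl, fun p => ?_, fun p => ?_⟩, ?_⟩
  · exact (Nat.cast_le.mpr (Multiset.card_le_card (hpre p))).trans_lt (hinhib p)
  · simp
  rintro M₄' - - ⟨b', hguard', hpre', -, hsucc'⟩ hequiv'
  refine hall (fun p => M₂ p - N.pre p t b' + N.post t p b') ⟨b', hguard',
    fun p => (hpre' p).trans (hM₄le p),
    fun p => (Nat.cast_le.mpr (hcard p)).trans_lt (hinhib p), fun p => rfl⟩ fun p θ hθ => ?_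
  obtain ⟨R₁, hR₁⟩ := Multiset.le_iff_exists_add.mp (hpre p)
  obtain ⟨R₂, hR₂⟩ := Multiset.le_iff_exists_add.mp (hM₄le p)
  obtain ⟨R₄, hR₄⟩ := Multiset.le_iff_exists_add.mp (hpre' p)
  have hM := heq p θ hθ
  have hE := hM₄equiv p θ hθ
  have hE' := hequiv' p θ hθ
  rw [hsucc' p] at hE'
  rw [hsucc p]
  dsimp only
  rw [hR₂, hR₄] at *
  rw [hR₁] at *
  simp only [add_assoc, add_tsub_cancel_left, countIn_add] at *
  omega

end
end
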